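/- arXiv:1809.06041 — 8 statements merged into one kernel-verified Lean document; each statement's English description precedes it below -/
import Mathlib

section
/- For every finite connected graph G, the pathbreadth of G is at most the strong pathbreadth of G, and the strong pathbreadth of G is at most 4 times the pathbreadth of G; that is, pb(G) ≤ spb(G) ≤ 4·pb(G). -/
open SimpleGraph

/-- The closed `r`-neighbourhood (ball) of a vertex `c` in `G`. -/
def closedBall {V : Type*} (G : SimpleGraph V) (c : V) (r : ℕ) : Set V :=
  {u | G.dist u c ≤ r}

/-- A (Robertson–Seymour) path decomposition of `G`, given as a sequence of bags
`bag 0, bag 1, …, bag len`. -/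
structure PathDecomp {V : Type*} (G : SimpleGraph V) where
  len : ℕ
  bag : ℕ → Set V
  mem_bag : ∀ x : V, ∃ i ≤ len, x ∈ bag i
  edge_bag : ∀ x y : V, G.Adj x y → ∃ i ≤ len, x ∈ bag i ∧ y ∈ bag i
  consec : ∀ (x : V) (i j k : ℕ), i ≤ j → j ≤ k → k ≤ len →
      x ∈ bag i → x ∈ bag k → x ∈ bag j

/-- The decomposition has breadth at most `r`: every bag is contained in the closed
`r`-neighbourhood of some vertex. -/
def HasBreadth {V : Type*} (G : SimpleGraph V) (D : PathDecomp G) (r : ℕ) : Prop :=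
  ∀ i ≤ D.len, ∃ c : V, D.bag i ⊆ closedBall G c r

/-- The decomposition has strong breadth `r`: every bag equals the closed
`r`-neighbourhood of some vertex. -/
def HasStrongBreadth {V : Type*} (G : SimpleGraph V) (D : PathDecomp G) (r : ℕ) : Prop :=
  ∀ i ≤ D.len, ∃ c : V, D.bag i = closedBall G c r

/-- The pathbreadth of `G`. -/
noncomputable def pb {V : Type*} (G : SimpleGraph V) : ℕ :=
  sInf {r | ∃ D : PathDecomp G, HasBreadth G D r}

/-- The strong pathbreadth of `G`. -/
noncomputable def spb {V : Type*} (G : SimpleGraph V) : ℕ :=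
  sInf {r | ∃ D : PathDecomp G, HasStrongBreadth G D r}

theorem bag_dist {V : Type*} {G : SimpleGraph V} (hG : G.Connected) {D : PathDecomp G} {r : ℕ}
    (hD : HasBreadth G D r) {s : ℕ} (hs : s ≤ D.len) {u w : V} (hu : u ∈ D.bag s)
    (hw : w ∈ D.bag s) : G.dist u w ≤ 2 * r := by
  obtain ⟨c, hc⟩ := hD s hs
  have h1 : G.dist u c ≤ r := hc hu
  have h2 : G.dist w c ≤ r := hc hw
  have h3 := hG.dist_triangle (u := u) (v := c) (w := w)
  rw [G.dist_comm (u := c)] at h3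
  omega

theorem geod {V : Type*} {G : SimpleGraph V} (hG : G.Connected) (u v : V) :
    ∃ f : ℕ → V, f 0 = u ∧ f (G.dist u v) = v ∧
      (∀ i < G.dist u v, G.Adj (f i) (f (i+1))) ∧
      (∀ i j, i ≤ j → j ≤ G.dist u v → G.dist (f i) (f j) = j - i) := by
  obtain ⟨p, hp⟩ := hG.exists_walk_length_eq_dist u v
  have hub : ∀ n i, i + n ≤ G.dist u v → G.dist (p.getVert i) (p.getVert (i + n)) ≤ n := by
    intro n
    induction n with
    | zero => intro i _; simp
    | succ n ih =>
      intro i hi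
      have h1 := ih i (by omega)
      have h2 : G.Adj (p.getVert (i+n)) (p.getVert (i+n+1)) := p.adj_getVert_succ (by omega)
      have h3 := hG.dist_triangle (u := p.getVert i) (v := p.getVert (i+n)) (w := p.getVert (i+n+1))
      rw [SimpleGraph.dist_eq_one_iff_adj.2 h2] at h3
      have : i + (n+1) = i + n + 1 := rfl
      rw [this]; omega
  refine ⟨p.getVert, by simp, by rw [← hp]; simp, fun i hi => p.adj_getVert_succ (by omega), ?_⟩
  intro i j hij hj
  have h1 := hub (j - i) i (by omega)
  have h2 := hub i 0 (by omega)
  have h3 := hub (G.dist u v - j) j (by omega)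
  rw [show i + (j - i) = j by omega] at h1
  rw [show j + (G.dist u v - j) = G.dist u v by omega] at h3
  have e : p.getVert (G.dist u v) = v := by rw [← hp]; simp
  rw [e] at h3
  rw [zero_add, p.getVert_zero] at h2
  have t1 := hG.dist_triangle (u := u) (v := p.getVert i) (w := v)
  have t2 := hG.dist_triangle (u := p.getVert i) (v := p.getVert j) (w := v)
  omega

theorem sep {V : Type*} {G : SimpleGraph V} (D : PathDecomp G) (f : ℕ → V) (s : ℕ) (n : ℕ) :
    ∀ (m i k : ℕ), (∀ t, m ≤ t → t < m + n → G.Adj (f t) (f (t+1))) → i ≤ D.len → k ≤ D.len →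
      f m ∈ D.bag i → f (m + n) ∈ D.bag k → ((i ≤ s ∧ s ≤ k) ∨ (k ≤ s ∧ s ≤ i)) →
      ∃ t, m ≤ t ∧ t ≤ m + n ∧ f t ∈ D.bag s := by
  induction n with
  | zero =>
    intro m i k _ hi hk h1 h2 h
    refine ⟨m, le_rfl, le_rfl, ?_⟩
    rcases h with h | h
    · exact D.consec _ i s k h.1 h.2 hk h1 h2
    · exact D.consec _ k s i h.1 h.2 hi h2 h1
  | succ n ih =>
    intro m i k hadj hi hk h1 h2 h
    obtain ⟨t, ht, ha, hb⟩ := D.edge_bag _ _ (hadj m le_rfl (by omega))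
    have key : ((t ≤ s ∧ s ≤ k) ∨ (k ≤ s ∧ s ≤ t)) →
        ∃ t, m ≤ t ∧ t ≤ m + (n+1) ∧ f t ∈ D.bag s := by
      intro h'
      obtain ⟨t', q1, q2, q3⟩ := ih (m+1) t k (fun t a b => hadj t (by omega) (by omega)) ht hk hb
        (by rw [show m + 1 + n = m + (n+1) by omega]; exact h2) h'
      exact ⟨t', by omega, by omega, q3⟩
    rcases h with h | h
    · by_cases c : t ≤ s
      · exact key (Or.inl ⟨c, h.2⟩)
      · exact ⟨m, le_rfl, by omega, D.consec _ i s t h.1 (by omega) ht h1 ha⟩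
    · by_cases c : s ≤ t
      · exact key (Or.inr ⟨h.1, c⟩)
      · exact ⟨m, le_rfl, by omega, D.consec _ t s i (by omega) h.2 hi ha h1⟩

theorem lemA {V : Type*} {G : SimpleGraph V} (hG : G.Connected) {D : PathDecomp G} {r : ℕ}
    (hD : HasBreadth G D r) {v p q : V} {t s k : ℕ} (ht : t ≤ D.len) (hs : s ≤ D.len)
    (hk : k ≤ D.len) (hv : v ∈ D.bag t) (hp : p ∈ D.bag s) (hq : q ∈ D.bag k)
    (h : (t ≤ s ∧ s ≤ k) ∨ (k ≤ s ∧ s ≤ t)) (hd : 4 * r ≤ G.dist p q)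
    (hvq : G.dist v q ≤ 4 * r) : G.dist v p ≤ 4 * r := by
  obtain ⟨f, f0, fL, fa, fd⟩ := geod hG v q
  obtain ⟨n, -, hn, hw⟩ := sep D f s (G.dist v q) 0 t k (fun t _ b => fa t (by omega)) ht hk
    (by rwa [f0]) (by rwa [zero_add, fL]) h
  have e1 := fd 0 n (by omega) (by omega)
  have e2 := fd n (G.dist v q) (by omega) le_rfl
  rw [f0] at e1
  rw [fL] at e2
  have b := bag_dist hG hD hs hp hw
  have t1 := hG.dist_triangle (u := v) (v := f n) (w := p)
  have t2 := hG.dist_triangle (u := p) (v := f n) (w := q)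
  rw [G.dist_comm (u := f n) (v := p)] at t1
  omega

theorem strong_of {V : Type*} {G : SimpleGraph V} (hG : G.Connected) (D : PathDecomp G) (r : ℕ)
    (hr : 0 < r) (hD : HasBreadth G D r) : ∃ D' : PathDecomp G, HasStrongBreadth G D' (4 * r) := by
  classical
  obtain ⟨z⟩ := hG.nonempty
  obtain ⟨iz, hiz, hz⟩ := D.mem_bag z
  -- extreme nonempty bags
  obtain ⟨a, x, ha, hx, hamin⟩ : ∃ a x, a ≤ D.len ∧ x ∈ D.bag a ∧
      ∀ i, i ≤ D.len → ∀ w ∈ D.bag i, a ≤ i := by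
    have hex : ∃ i, i ≤ D.len ∧ ∃ w, w ∈ D.bag i := ⟨iz, hiz, z, hz⟩
    obtain ⟨h1, w, hw⟩ := Nat.find_spec hex
    exact ⟨Nat.find hex, w, h1, hw, fun i hi w hw => Nat.find_min' hex ⟨hi, w, hw⟩⟩
  obtain ⟨b, y, hb, hy, hbmax⟩ : ∃ b y, b ≤ D.len ∧ y ∈ D.bag b ∧
      ∀ i, i ≤ D.len → ∀ w ∈ D.bag i, i ≤ b := by
    have hex : ∃ i, i ≤ D.len ∧ ∃ w, w ∈ D.bag (D.len - i) :=
      ⟨D.len - iz, by omega, z, by rwa [show D.len - (D.len - iz) = iz by omega]⟩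
    obtain ⟨h1, w, hw⟩ := Nat.find_spec hex
    refine ⟨D.len - Nat.find hex, w, by omega, hw, fun i hi w hw => ?_⟩
    have := Nat.find_min' hex (m := D.len - i)
      ⟨by omega, w, by rwa [show D.len - (D.len - i) = i by omega]⟩
    omega
  obtain ⟨f, f0, fL, fa, fd⟩ := geod hG x y
  generalize hL : G.dist x y = L at fL fa fd
  -- the offset and the number of bags
  obtain ⟨o, N, ho, hN, hN2⟩ : ∃ o N, o ≤ 2 * r ∧ o + 4 * r * N ≤ L ∧ L ≤ o + 4 * r * N + 2 * r := by
    have e := Nat.div_add_mod L (4 * r)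
    have e2 := Nat.mod_lt L (show 0 < 4 * r by omega)
    by_cases c : L % (4*r) ≤ 2 * r
    · exact ⟨L % (4*r), L / (4*r), by omega, by omega, by omega⟩
    · exact ⟨2*r, L / (4*r), by omega, by omega, by omega⟩
  have near : ∀ n ≤ L, ∃ j ≤ N, G.dist (f n) (f (o + 4 * r * j)) ≤ 2 * r := by
    intro n hn
    obtain ⟨j, hj, h1, h2⟩ : ∃ j ≤ N, n ≤ o + 4 * r * j + 2 * r ∧ o + 4 * r * j ≤ n + 2 * r := by
      have hex : ∃ j, n ≤ o + 4 * r * j + 2 * r := ⟨N, by omega⟩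
      refine ⟨Nat.find hex, Nat.find_min' hex (by omega), Nat.find_spec hex, ?_⟩
      rcases Nat.eq_zero_or_pos (Nat.find hex) with h | h
      · rw [h]; omega
      · have := Nat.find_min hex (m := Nat.find hex - 1) (by omega)
        obtain ⟨m, hm⟩ : ∃ m, Nat.find hex = m + 1 := ⟨Nat.find hex - 1, by omega⟩
        rw [hm] at this ⊢
        rw [Nat.add_sub_cancel] at this
        rw [Nat.mul_add]
        omega
    have hjN : 4 * r * j ≤ 4 * r * N := Nat.mul_le_mul_left _ hj
    refine ⟨j, hj, ?_⟩
    rcases le_total n (o + 4 * r * j) with c | c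
    · rw [fd _ _ c (by omega)]; omega
    · rw [G.dist_comm, fd _ _ c hn]; omega
  have cover : ∀ s ≤ D.len, ∀ w ∈ D.bag s, ∃ j ≤ N,
      ∀ u ∈ D.bag s, u ∈ closedBall G (f (o + 4 * r * j)) (4 * r) := by
    intro s hs w hw
    obtain ⟨n, -, hn, hfn⟩ := sep D f s L 0 a b (fun t _ h => fa t (by omega)) ha hb
      (by rwa [f0]) (by rwa [zero_add, fL]) (Or.inl ⟨hamin s hs w hw, hbmax s hs w hw⟩)
    obtain ⟨j, hj, hd⟩ := near n (by omega)
    refine ⟨j, hj, fun u hu => ?_⟩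
    have h1 := bag_dist hG hD hs hu hfn
    have h2 := hG.dist_triangle (u := u) (v := f n) (w := f (o + 4 * r * j))
    show G.dist u _ ≤ _
    omega
  have conv : ∀ v i j k, i + 4 * r ≤ j → j + 4 * r ≤ k → k ≤ L → G.dist v (f i) ≤ 4 * r →
      G.dist v (f k) ≤ 4 * r → G.dist v (f j) ≤ 4 * r := by
    intro v i j k hij hjk hk hi hk'
    obtain ⟨t, ht, hvt⟩ := D.mem_bag v
    obtain ⟨s, hs, hjs⟩ := D.mem_bag (f j)
    obtain ⟨ri, hri, hfi⟩ := D.mem_bag (f i)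
    obtain ⟨rk, hrk, hfk⟩ := D.mem_bag (f k)
    by_cases c1 : (t ≤ s ∧ s ≤ ri) ∨ (ri ≤ s ∧ s ≤ t)
    · exact lemA hG hD ht hs hri hvt hjs hfi c1
        (by rw [G.dist_comm, fd _ _ (by omega) (by omega)]; omega) hi
    by_cases c2 : (t ≤ s ∧ s ≤ rk) ∨ (rk ≤ s ∧ s ≤ t)
    · exact lemA hG hD ht hs hrk hvt hjs hfk c2
        (by rw [fd _ _ (by omega) (by omega)]; omega) hk'
    exfalso
    rcases le_total s ri with c | c
    · obtain ⟨n, -, hn, hfn⟩ := sep D f s i 0 a ri (fun t _ h => fa t (by omega)) ha hri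
        (by rwa [f0]) (by rwa [zero_add]) (Or.inl ⟨hamin s hs _ hjs, c⟩)
      have h1 := bag_dist hG hD hs hfn hjs
      rw [fd _ _ (by omega) (by omega)] at h1
      omega
    · obtain ⟨n, hn, hn', hfn⟩ := sep D f s (L - k) k rk b (fun t _ h => fa t (by omega)) hrk hb
        hfk (by rwa [show k + (L - k) = L by omega, fL])
        (Or.inl ⟨by omega, hbmax s hs _ hjs⟩)
      have h1 := bag_dist hG hD hs hjs hfn
      rw [fd _ _ (by omega) (by omega)] at h1
      omega
  refine ⟨⟨N, fun j => closedBall G (f (o + 4 * r * j)) (4 * r), ?_, ?_, ?_⟩, fun i _ => ⟨_, rfl⟩⟩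
  · intro v
    obtain ⟨s, hs, hv⟩ := D.mem_bag v
    obtain ⟨j, hj, h⟩ := cover s hs v hv
    exact ⟨j, hj, h v hv⟩
  · intro u v huv
    obtain ⟨s, hs, hu, hv⟩ := D.edge_bag u v huv
    obtain ⟨j, hj, h⟩ := cover s hs v hv
    exact ⟨j, hj, h u hu, h v hv⟩
  · intro v i j k hij hjk hk hi hk'
    rcases hij.eq_or_lt with rfl | hij
    · exact hi
    rcases hjk.eq_or_lt with rfl | hjk
    · exact hk'
    have e1 : 4 * r * (i + 1) ≤ 4 * r * j := Nat.mul_le_mul_left _ hij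
    have e2 : 4 * r * (j + 1) ≤ 4 * r * k := Nat.mul_le_mul_left _ hjk
    have e3 : 4 * r * k ≤ 4 * r * N := Nat.mul_le_mul_left _ hk
    rw [Nat.mul_add] at e1 e2
    exact conv v _ _ _ (by omega) (by omega) (by omega) hi hk'

theorem strong_of_bound {V : Type*} {G : SimpleGraph V} (c : V) (r : ℕ)
    (h : ∀ u, G.dist u c ≤ r) : ∃ D' : PathDecomp G, HasStrongBreadth G D' r :=
  ⟨⟨0, fun _ => closedBall G c r, fun x => ⟨0, le_rfl, h x⟩,
    fun x y _ => ⟨0, le_rfl, h x, h y⟩, fun _ _ _ _ _ _ _ h _ => h⟩, fun _ _ => ⟨c, rfl⟩⟩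

theorem pb_le_spb_le_four_pb {V : Type*} [Fintype V] (G : SimpleGraph V)
    (hG : G.Connected) :
    pb G ≤ spb G ∧ spb G ≤ 4 * pb G := by
  obtain ⟨c⟩ := hG.nonempty
  have hne : {r | ∃ D : PathDecomp G, HasStrongBreadth G D r}.Nonempty :=
    ⟨∑ u, G.dist u c, strong_of_bound c _ fun u =>
      Finset.single_le_sum (f := fun u => G.dist u c) (fun _ _ => Nat.zero_le _)
        (Finset.mem_univ u)⟩
  have hle : ∃ D : PathDecomp G, HasBreadth G D (spb G) := by
    obtain ⟨D, hD⟩ := Nat.sInf_mem hne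
    exact ⟨D, fun i hi => (hD i hi).imp fun c h => h.subset⟩
  refine ⟨Nat.sInf_le hle, Nat.sInf_le ?_⟩
  obtain ⟨D, hD⟩ : ∃ D : PathDecomp G, HasBreadth G D (pb G) :=
    Nat.sInf_mem (s := {r | ∃ D : PathDecomp G, HasBreadth G D r}) ⟨_, hle⟩
  rcases Nat.eq_zero_or_pos (pb G) with h0 | hpos
  · rw [h0] at hD
    refine strong_of_bound c _ fun u => ?_
    by_contra hcon
    obtain ⟨f, f0, -, fa, -⟩ := geod hG u c
    have hadj := fa 0 (by omega)
    obtain ⟨s, hs, h1, h2⟩ := D.edge_bag _ _ hadj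
    have := bag_dist hG hD hs h1 h2
    rw [SimpleGraph.dist_eq_one_iff_adj.2 hadj] at this
    omega
  · exact strong_of hG D _ hpos hD
end

section
/- Let G be a finite connected graph and let P = (v_0, v_1, …, v_ℓ) be a shortest path of G with eccentricity λ ≥ 1. Set L = ⌊ℓ/(2λ)⌋, δ = ⌊(ℓ mod 2λ)/2⌋, q_i = v_{2λ·i + δ} for 0 ≤ i ≤ L, and B_i = N^{2λ}[q_i]. Then the sequence Φ = (B_0, B_1, …, B_L) is a path decomposition of G with strong breadth 2λ (every bag is the complete closed 2λ-neighbourhood of a vertex). -/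
open SimpleGraph

/-- `v 0, v 1, …, v ℓ` is a shortest path of `G`:
consecutive vertices are adjacent and `d(v i, v j) = |i - j|`. -/
def IsShortestPath {V : Type*} (G : SimpleGraph V) (ℓ : ℕ) (v : ℕ → V) : Prop :=
  (∀ i < ℓ, G.Adj (v i) (v (i + 1))) ∧
  (∀ i j : ℕ, i ≤ ℓ → j ≤ ℓ → G.dist (v i) (v j) = ((i : ℤ) - (j : ℤ)).natAbs)

/-- The path `v 0, …, v ℓ` has eccentricity `lam` in `G`: every vertex of `G` is within
distance `lam` of the path, and some vertex is at distance at least `lam` from every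
vertex of the path. -/
def PathEcc {V : Type*} (G : SimpleGraph V) (ℓ : ℕ) (v : ℕ → V) (lam : ℕ) : Prop :=
  (∀ u : V, ∃ i ≤ ℓ, G.dist u (v i) ≤ lam) ∧
  (∃ u : V, ∀ i ≤ ℓ, lam ≤ G.dist u (v i))

theorem aux_near (ℓ lam : ℕ) (hlam : 1 ≤ lam) (a : ℕ) (ha : a ≤ ℓ) :
    ∃ i ≤ ℓ / (2 * lam), a + lam ≥ 2 * lam * i + (ℓ % (2 * lam)) / 2 + 1 ∧
      a ≤ 2 * lam * i + (ℓ % (2 * lam)) / 2 + lam := by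
  have h1 := Nat.div_add_mod ℓ (2 * lam)
  have h2 := Nat.mod_lt ℓ (show 2 * lam > 0 by omega)
  generalize hr : ℓ % (2 * lam) = r at *
  generalize hL : ℓ / (2 * lam) = L at *
  have h3 := Nat.div_add_mod (a + lam - r / 2 - 1) (2 * lam)
  have h4 := Nat.mod_lt (a + lam - r / 2 - 1) (show 2 * lam > 0 by omega)
  refine ⟨(a + lam - r / 2 - 1) / (2 * lam), ?_, by omega, by omega⟩
  apply Nat.le_of_lt_succ
  rw [Nat.div_lt_iff_lt_mul (by omega)]
  have : L.succ * (2 * lam) = 2 * lam * L + 2 * lam := by rw [Nat.succ_eq_add_one]; ring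
  omega

theorem algo_output_is_path_decomp_strong_breadth {V : Type*} [Fintype V]
    (G : SimpleGraph V) (hG : G.Connected) (ℓ lam : ℕ) (hlam : 1 ≤ lam)
    (v : ℕ → V) (hsp : IsShortestPath G ℓ v) (hecc : PathEcc G ℓ v lam) :
    let L := ℓ / (2 * lam)
    let δ := (ℓ % (2 * lam)) / 2
    let q : ℕ → V := fun i => v (2 * lam * i + δ)
    (∀ x : V, ∃ i ≤ L, x ∈ closedBall G (q i) (2 * lam)) ∧
    (∀ x y : V, G.Adj x y →
      ∃ i ≤ L, x ∈ closedBall G (q i) (2 * lam) ∧ y ∈ closedBall G (q i) (2 * lam)) ∧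
    (∀ (x : V) (i j k : ℕ), i ≤ j → j ≤ k → k ≤ L →
      x ∈ closedBall G (q i) (2 * lam) → x ∈ closedBall G (q k) (2 * lam) →
      x ∈ closedBall G (q j) (2 * lam)) ∧
    (∀ i ≤ L, ∃ c : V, closedBall G (q i) (2 * lam) = closedBall G c (2 * lam)) := by
  intro L δ q
  obtain ⟨-, hd⟩ := hsp
  obtain ⟨hc, -⟩ := hecc
  have hdiv := Nat.div_add_mod ℓ (2 * lam)
  have hpos : ∀ i ≤ L, 2 * lam * i + δ ≤ ℓ := by
    intro i hi
    have h1 : 2 * lam * i ≤ 2 * lam * L := Nat.mul_le_mul_left _ hi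
    have h2 : δ ≤ ℓ % (2 * lam) := Nat.div_le_self _ _
    have h3 : 2 * lam * L + ℓ % (2 * lam) = ℓ := hdiv
    omega
  have hnear : ∀ a ≤ ℓ, ∃ i ≤ L, a + lam ≥ 2 * lam * i + δ + 1 ∧ a ≤ 2 * lam * i + δ + lam :=
    fun a ha => aux_near ℓ lam hlam a ha
  have tri : ∀ x y z : V, G.dist x z ≤ G.dist x y + G.dist y z := fun x y z => hG.dist_triangle
  have hmem : ∀ x i, x ∈ closedBall G (q i) (2 * lam) ↔
      G.dist x (v (2 * lam * i + δ)) ≤ 2 * lam := fun x i => Iff.rfl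
  have hstep : ∀ i j : ℕ, i + 1 ≤ j → 2 * lam * i + 2 * lam ≤ 2 * lam * j := by
    intro i j h
    have := Nat.mul_le_mul_left (2 * lam) h
    rw [Nat.mul_add] at this
    omega
  clear_value L δ q
  have hedge : ∀ x y : V, G.Adj x y →
      ∃ i ≤ L, G.dist x (v (2 * lam * i + δ)) ≤ 2 * lam ∧
        G.dist y (v (2 * lam * i + δ)) ≤ 2 * lam := by
    intro x y hxy
    have hxy1 : G.dist x y = 1 := SimpleGraph.dist_eq_one_iff_adj.2 hxy
    have hyx1 : G.dist y x = 1 := SimpleGraph.dist_eq_one_iff_adj.2 hxy.symm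
    obtain ⟨a, ha, hxa⟩ := hc x
    obtain ⟨b, hb, hyb⟩ := hc y
    obtain ⟨i, hi, hi1, hi2⟩ := hnear a ha
    obtain ⟨j, hj, hj1, hj2⟩ := hnear b hb
    have pi := hpos i hi
    have pj := hpos j hj
    have dai := hd a _ ha pi
    have daj := hd a _ ha pj
    have dbi := hd b _ hb pi
    have dbj := hd b _ hb pj
    have dab := hd a b ha hb
    have t1 := tri x (v a) (v (2 * lam * i + δ))
    have t2 := tri x (v a) (v (2 * lam * j + δ))
    have t3 := tri y (v b) (v (2 * lam * i + δ))
    have t4 := tri y (v b) (v (2 * lam * j + δ))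
    have t5 := tri x y (v (2 * lam * j + δ))
    have t6 := tri y x (v (2 * lam * i + δ))
    have t7 := tri (v a) x (v b)
    have t8 := tri x y (v b)
    rw [G.dist_comm (u := v a) (v := x)] at t7
    by_cases h1 : a + 1 ≤ 2 * lam * i + δ + lam
    · exact ⟨i, hi, by omega, by omega⟩
    by_cases h2 : b + 1 ≤ 2 * lam * j + δ + lam
    · exact ⟨j, hj, by omega, by omega⟩
    rcases lt_trichotomy i j with h | h | h
    · have s1 := hstep i j h
      have s2 : j = i + 1 := by
        by_contra hne
        have e1 := hstep i (i + 1) le_rfl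
        have e2 := hstep (i + 1) j (by omega)
        omega
      have s3 : 2 * lam * j = 2 * lam * i + 2 * lam := by rw [s2]; ring
      exact ⟨j, hj, by omega, by omega⟩
    · subst h
      exact ⟨i, hi, by omega, by omega⟩
    · have s2 : i = j + 1 := by
        by_contra hne
        have e1 := hstep j (j + 1) le_rfl
        have e2 := hstep (j + 1) i (by omega)
        omega
      have s3 : 2 * lam * i = 2 * lam * j + 2 * lam := by rw [s2]; ring
      exact ⟨i, hi, by omega, by omega⟩
  refine ⟨?_, ?_, ?_, fun i _ => ⟨q i, rfl⟩⟩
  · intro x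
    obtain ⟨a, ha, hxa⟩ := hc x
    obtain ⟨i, hi, hi1, hi2⟩ := hnear a ha
    have dai := hd a _ ha (hpos i hi)
    have t1 := tri x (v a) (v (2 * lam * i + δ))
    exact ⟨i, hi, (hmem x i).2 (by omega)⟩
  · intro x y hxy
    obtain ⟨i, hi, h1, h2⟩ := hedge x y hxy
    exact ⟨i, hi, (hmem x i).2 h1, (hmem y i).2 h2⟩
  · intro x i j k hij hjk hk hxi hxk
    rcases hij.eq_or_lt with h | hij
    · exact h ▸ hxi
    rcases hjk.eq_or_lt with h | hjk
    · exact h ▸ hxk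
    rw [hmem] at *
    obtain ⟨a, ha, hxa⟩ := hc x
    have dai := hd a _ ha (hpos i (by omega))
    have daj := hd a _ ha (hpos j (by omega))
    have dak := hd a _ ha (hpos k hk)
    have t1 := tri x (v a) (v (2 * lam * j + δ))
    have t2 := tri (v a) x (v (2 * lam * i + δ))
    have t3 := tri (v a) x (v (2 * lam * k + δ))
    rw [G.dist_comm (u := v a) (v := x)] at t2 t3
    have s1 := hstep i j hij
    have s2 := hstep j k hjk
    omega
end

section
/- Let G be a finite connected graph and let P = (v_0, v_1, …, v_ℓ) be a shortest path of G with eccentricity λ ≥ 1. Set L = ⌊ℓ/(2λ)⌋, δ = ⌊(ℓ mod 2λ)/2⌋, and q_i = v_{2λ·i + δ} for 0 ≤ i ≤ L. Then the set Q = {q_0, …, q_L} λ-dominates the path P (every vertex v_j of P is within distance λ of some q_i), and consequently the union of the bags B_i = N^{2λ}[q_i] over 0 ≤ i ≤ L equals the whole vertex set of G. -/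
open SimpleGraph

theorem centers_dominate_and_bags_cover {V : Type*} [Fintype V]
    (G : SimpleGraph V) (hG : G.Connected) (ℓ lam : ℕ) (hlam : 1 ≤ lam)
    (v : ℕ → V) (hsp : IsShortestPath G ℓ v) (hecc : PathEcc G ℓ v lam) :
    let L := ℓ / (2 * lam)
    let δ := (ℓ % (2 * lam)) / 2
    let q : ℕ → V := fun i => v (2 * lam * i + δ)
    (∀ j ≤ ℓ, ∃ i ≤ L, G.dist (v j) (q i) ≤ lam) ∧
    (⋃ i ≤ L, closedBall G (q i) (2 * lam)) = Set.univ := by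
  intro L δ q
  have key : ∀ j ≤ ℓ, ∃ i ≤ L, G.dist (v j) (q i) ≤ lam := by
    intro j hj
    have h1 := Nat.div_add_mod ℓ (2 * lam)
    have h2 := Nat.mod_lt ℓ (show 0 < 2 * lam by omega)
    have h3 := Nat.div_add_mod j (2 * lam)
    have h4 := Nat.mod_lt j (show 0 < 2 * lam by omega)
    have h5 : j / (2 * lam) ≤ ℓ / (2 * lam) := Nat.div_le_div_right hj
    have hδ : δ = (ℓ % (2 * lam)) / 2 := rfl
    have hL : L = ℓ / (2 * lam) := rfl
    rw [← hL] at h1 h5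
    have hpos : ∀ i ≤ L, 2 * lam * i + δ ≤ ℓ := by
      intro i hi
      have := Nat.mul_le_mul_left (2 * lam) hi
      omega
    generalize j / (2 * lam) = a at *
    by_cases hb : j % (2 * lam) ≤ δ + lam
    · refine ⟨a, h5, ?_⟩
      have hp := hpos _ h5
      change G.dist (v j) (v (2 * lam * a + δ)) ≤ lam
      rw [hsp.2 _ _ hj hp]
      omega
    · have ha : a + 1 ≤ L := by
        rcases Nat.lt_or_ge a L with h | h
        · exact h
        · have : a = L := le_antisymm h5 h
          subst this
          omega
      refine ⟨a + 1, ha, ?_⟩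
      have hp := hpos _ ha
      change G.dist (v j) (v (2 * lam * (a + 1) + δ)) ≤ lam
      rw [hsp.2 _ _ hj hp]
      rw [Nat.mul_add] at *
      omega
  refine ⟨key, ?_⟩
  ext u
  simp only [Set.mem_iUnion, Set.mem_univ, iff_true]
  obtain ⟨j, hj, hu⟩ := hecc.1 u
  obtain ⟨i, hi, hd⟩ := key j hj
  refine ⟨i, hi, ?_⟩
  have := hG.dist_triangle (u := u) (v := v j) (w := q i)
  change G.dist u (q i) ≤ 2 * lam
  omega
end

section
/- Let G be a finite connected graph and let P = (v_0, v_1, …, v_ℓ) be a shortest path of G with eccentricity λ ≥ 1. Set L = ⌊ℓ/(2λ)⌋, δ = ⌊(ℓ mod 2λ)/2⌋, and q_i = v_{2λ·i + δ} for 0 ≤ i ≤ L. Then for every edge xy of G there exists an index i with 0 ≤ i ≤ L such that both x and y belong to N^{2λ}[q_i]. -/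
open SimpleGraph

theorem idx_aux (ℓ lam a : ℕ) (hlam : 1 ≤ lam) (ha : a ≤ ℓ) :
    ∃ i ≤ ℓ / (2 * lam),
      (a + 1 ≤ 2 * lam * i + (ℓ % (2 * lam)) / 2 + lam ∧
        2 * lam * i + (ℓ % (2 * lam)) / 2 + 1 ≤ a + lam) ∨
      a = 2 * lam * i + (ℓ % (2 * lam)) / 2 + lam := by
  have h1 := Nat.div_add_mod ℓ (2 * lam)
  have h2 := Nat.mod_lt ℓ (show 2 * lam > 0 by omega)
  generalize ℓ / (2 * lam) = L at *
  generalize ℓ % (2 * lam) = r at *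
  by_cases hd : a < r / 2
  · exact ⟨0, Nat.zero_le _, Or.inl (by simp only [mul_zero]; omega)⟩
  have h3 := Nat.div_add_mod (a - r / 2) (2 * lam)
  have h4 := Nat.mod_lt (a - r / 2) (show 2 * lam > 0 by omega)
  generalize (a - r / 2) / (2 * lam) = t at *
  generalize (a - r / 2) % (2 * lam) = s at *
  have hle : t ≤ L := by
    by_contra h
    have := Nat.mul_le_mul_left (2 * lam) (show L + 1 ≤ t by omega)
    rw [mul_add] at this
    omega
  by_cases hs : s ≤ lam
  · refine ⟨t, hle, ?_⟩
    omega
  · refine ⟨t + 1, ?_, Or.inl ?_⟩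
    · by_contra h
      have : t = L := by omega
      subst this
      omega
    · rw [mul_add]
      omega

theorem edges_covered_by_bags {V : Type*} [Fintype V]
    (G : SimpleGraph V) (hG : G.Connected) (ℓ lam : ℕ) (hlam : 1 ≤ lam)
    (v : ℕ → V) (hsp : IsShortestPath G ℓ v) (hecc : PathEcc G ℓ v lam) :
    let L := ℓ / (2 * lam)
    let δ := (ℓ % (2 * lam)) / 2
    let q : ℕ → V := fun i => v (2 * lam * i + δ)
    ∀ x y : V, G.Adj x y →
      ∃ i ≤ L, x ∈ closedBall G (q i) (2 * lam) ∧ y ∈ closedBall G (q i) (2 * lam) := by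
  intro L δ q x y hxy
  obtain ⟨hecc, -⟩ := hecc
  obtain ⟨-, hd⟩ := hsp
  obtain ⟨a, ha, hxa⟩ := hecc x
  obtain ⟨b, hb, hyb⟩ := hecc y
  have hxy1 : G.dist x y = 1 := SimpleGraph.dist_eq_one_iff_adj.mpr hxy
  have hyx1 : G.dist y x = 1 := SimpleGraph.dist_eq_one_iff_adj.mpr hxy.symm
  have hq : ∀ i ≤ L, 2 * lam * i + δ ≤ ℓ := by
    intro i hi
    have h1 := Nat.div_add_mod ℓ (2 * lam)
    have h2 := Nat.mul_le_mul_left (2 * lam) hi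
    simp only [L, δ] at *
    omega
  have hab : G.dist (v a) (v b) ≤ 2 * lam + 1 := by
    have h1 := hG.dist_triangle (u := v a) (v := x) (w := v b)
    have h2 := hG.dist_triangle (u := x) (v := y) (w := v b)
    have h3 := SimpleGraph.dist_comm (G := G) (u := v a) (v := x)
    omega
  rw [hd a b ha hb] at hab
  have key : ∀ i ≤ L, ∀ z c, c ≤ ℓ →  G.dist z (v c) ≤ lam →
      G.dist z (q i) ≤ lam + ((c : ℤ) - ((2 * lam * i + δ : ℕ) : ℤ)).natAbs := by
    intro i hi z c hc hz
    have h1 := hG.dist_triangle (u := z) (v := v c) (w := q i)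
    have h2 := hd c _ hc (hq i hi)
    simp only [q] at *
    omega
  obtain ⟨i, hi, hi'⟩ := idx_aux ℓ lam a hlam ha
  obtain ⟨j, hj, hj'⟩ := idx_aux ℓ lam b hlam hb
  change i ≤ L at hi
  change j ≤ L at hj
  change (a + 1 ≤ 2 * lam * i + δ + lam ∧ 2 * lam * i + δ + 1 ≤ a + lam) ∨
    a = 2 * lam * i + δ + lam at hi'
  change (b + 1 ≤ 2 * lam * j + δ + lam ∧ 2 * lam * j + δ + 1 ≤ b + lam) ∨
    b = 2 * lam * j + δ + lam at hj'
  have kxi := key i hi x a ha hxa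
  have kyj := key j hj y b hb hyb
  have kyi := key i hi y b hb hyb
  have kxj := key j hj x a ha hxa
  have t1 := hG.dist_triangle (u := y) (v := x) (w := q i)
  have t2 := hG.dist_triangle (u := x) (v := y) (w := q j)
  simp only [closedBall, Set.mem_ofPred_eq]
  clear_value L δ q
  rcases hi' with hi' | hi'
  · exact ⟨i, hi, by omega, by omega⟩
  rcases hj' with hj' | hj'
  · exact ⟨j, hj, by omega, by omega⟩
  rcases lt_trichotomy i j with h | h | h
  · have h5 : j = i + 1 := by
      by_contra hne
      have := Nat.mul_le_mul_left (2 * lam) (show i + 2 ≤ j by omega)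
      rw [mul_add] at this
      omega
    subst h5
    simp only [mul_add] at *
    exact ⟨i + 1, hj, by omega, by omega⟩
  · subst h
    exact ⟨i, hi, by omega, by omega⟩
  · have h5 : i = j + 1 := by
      by_contra hne
      have := Nat.mul_le_mul_left (2 * lam) (show j + 2 ≤ i by omega)
      rw [mul_add] at this
      omega
    subst h5
    simp only [mul_add] at *
    exact ⟨j + 1, hi, by omega, by omega⟩
end

section
/- Let G be a finite connected graph and let P = (v_0, v_1, …, v_ℓ) be a shortest path of G with eccentricity λ ≥ 1. Set L = ⌊ℓ/(2λ)⌋, δ = ⌊(ℓ mod 2λ)/2⌋, and q_i = v_{2λ·i + δ} for 0 ≤ i ≤ L. Then for every vertex x of G, the set of indices { i : 0 ≤ i ≤ L and x ∈ N^{2λ}[q_i] } is an interval of consecutive integers; that is, if x ∈ N^{2λ}[q_j] and x ∈ N^{2λ}[q_k] with j < i < k, then x ∈ N^{2λ}[q_i]. -/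
open SimpleGraph

theorem bags_containing_vertex_consecutive {V : Type*} [Fintype V]
    (G : SimpleGraph V) (hG : G.Connected) (ℓ lam : ℕ) (hlam : 1 ≤ lam)
    (v : ℕ → V) (hsp : IsShortestPath G ℓ v) (hecc : PathEcc G ℓ v lam) :
    let L := ℓ / (2 * lam)
    let δ := (ℓ % (2 * lam)) / 2
    let q : ℕ → V := fun i => v (2 * lam * i + δ)
    ∀ (x : V) (j i k : ℕ), j < i → i < k → k ≤ L →
      x ∈ closedBall G (q j) (2 * lam) → x ∈ closedBall G (q k) (2 * lam) →
      x ∈ closedBall G (q i) (2 * lam) := by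
  intro L δ q x j i k hji hik hkL hj hk
  simp only [closedBall, Set.mem_setOf_eq, q] at hj hk ⊢
  obtain ⟨m, hm, hxm⟩ := hecc.1 x
  have hdm : 2 * lam * L + ℓ % (2 * lam) = ℓ := Nat.div_add_mod ℓ (2 * lam)
  have hδ : δ ≤ ℓ % (2 * lam) := Nat.div_le_self _ _
  have h1 : 2 * lam * k ≤ 2 * lam * L := Nat.mul_le_mul_left _ hkL
  have h2 : 2 * lam * (i + 1) ≤ 2 * lam * k := Nat.mul_le_mul_left _ hik
  have h3 : 2 * lam * (j + 1) ≤ 2 * lam * i := Nat.mul_le_mul_left _ hji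
  rw [Nat.mul_add, Nat.mul_one] at h2 h3
  generalize 2 * lam * k = a at *
  generalize 2 * lam * i = b at *
  generalize 2 * lam * j = c at *
  generalize 2 * lam * L = d at *
  generalize ℓ % (2 * lam) = r at *
  have ej := hsp.2 m (c + δ) hm (by omega)
  have ek := hsp.2 m (a + δ) hm (by omega)
  have ei := hsp.2 m (b + δ) hm (by omega)
  have tj := hG.dist_triangle (u := v m) (v := x) (w := v (c + δ))
  have tk := hG.dist_triangle (u := v m) (v := x) (w := v (a + δ))
  have ti := hG.dist_triangle (u := x) (v := v m) (w := v (b + δ))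
  rw [G.dist_comm (u := v m) (v := x)] at tj tk
  omega
end

section
/- Let G be a finite connected graph. If G contains a shortest path of eccentricity λ ≥ 1, then the strong pathbreadth of G is at most 2λ; that is, spb(G) ≤ 2λ. -/
open SimpleGraph

theorem spb_le_two_ecc {V : Type*} [Fintype V]
    (G : SimpleGraph V) (hG : G.Connected) (ℓ lam : ℕ) (hlam : 1 ≤ lam)
    (v : ℕ → V) (hsp : IsShortestPath G ℓ v) (hecc : PathEcc G ℓ v lam) :
    spb G ≤ 2 * lam := by
  obtain ⟨-, hd⟩ := hsp
  obtain ⟨hc, -⟩ := hecc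
  obtain ⟨K, ρ, hℓ, hρ⟩ : ∃ K ρ, ℓ = 2 * lam * K + ρ ∧ ρ < 2 * lam :=
    ⟨ℓ / (2 * lam), ℓ % (2 * lam), (Nat.div_add_mod _ _).symm, Nat.mod_lt _ (by omega)⟩
  obtain ⟨s, hs1, hs2, hs3⟩ : ∃ s, s ≤ lam ∧ s ≤ ρ ∧ ρ < s + lam :=
    ⟨(ρ + 1) / 2, by omega, by omega, by omega⟩
  have tri : ∀ x y z : V, G.dist x z ≤ G.dist x y + G.dist y z :=
    fun x y z => hG.dist_triangle
  have cle : ∀ k ≤ K, s + 2 * lam * k ≤ ℓ := by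
    intro k hk
    have := Nat.mul_le_mul_left (2 * lam) hk
    omega
  -- every vertex has a block
  have blk : ∀ x : V, ∃ a ≤ ℓ, G.dist x (v a) ≤ lam ∧ ∃ k ≤ K, ∃ r < 2 * lam,
      a + lam = s + 2 * lam * k + r := by
    intro x
    obtain ⟨a, ha, hxa⟩ := hc x
    refine ⟨a, ha, hxa, (a + lam - s) / (2 * lam), ?_, (a + lam - s) % (2 * lam),
      Nat.mod_lt _ (by omega), ?_⟩
    · rw [← Nat.lt_succ_iff, Nat.div_lt_iff_lt_mul (by omega), Nat.succ_mul, Nat.mul_comm K]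
      omega
    · have := Nat.div_add_mod (a + lam - s) (2 * lam)
      omega
  have hv : ∀ i j, i ≤ ℓ → j ≤ ℓ → i ≤ G.dist (v i) (v j) + j ∧ j ≤ G.dist (v i) (v j) + i ∧
      (G.dist (v i) (v j) + i = j ∨ G.dist (v i) (v j) + j = i) := by
    intro i j hi hj
    have := hd i j hi hj
    omega
  apply Nat.sInf_le
  refine ⟨⟨K, fun k => closedBall G (v (s + 2 * lam * k)) (2 * lam), ?_, ?_, ?_⟩,
    fun i _ => ⟨_, rfl⟩⟩
  · intro x
    obtain ⟨a, ha, hxa, k, hk, r, hr, e⟩ := blk x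
    refine ⟨k, hk, ?_⟩
    have h1 := tri x (v a) (v (s + 2 * lam * k))
    have h2 := hv a _ ha (cle k hk)
    simp only [closedBall, Set.mem_setOf_eq]
    omega
  · intro x y hxy
    obtain ⟨a, ha, hxa, k, hk, r, hr, e⟩ := blk x
    obtain ⟨b, hb, hyb, k', hk', r', hr', e'⟩ := blk y
    have hxy1 : G.dist x y = 1 := dist_eq_one_iff_adj.2 hxy
    have hyx1 : G.dist y x = 1 := dist_eq_one_iff_adj.2 hxy.symm
    simp only [closedBall, Set.mem_setOf_eq]
    have h1 := tri x (v a) (v (s + 2 * lam * k))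
    have h2 := hv a _ ha (cle k hk)
    have h3 := tri y x (v (s + 2 * lam * k))
    have h1' := tri y (v b) (v (s + 2 * lam * k'))
    have h2' := hv b _ hb (cle k' hk')
    have h3' := tri x y (v (s + 2 * lam * k'))
    have g1 := tri y (v b) (v (s + 2 * lam * k))
    have g2 := hv b _ hb (cle k hk)
    have g1' := tri x (v a) (v (s + 2 * lam * k'))
    have g2' := hv a _ ha (cle k' hk')
    by_cases hr0 : 0 < r
    · exact ⟨k, hk, by omega, by omega⟩
    by_cases hr0' : 0 < r'
    · exact ⟨k', hk', by omega, by omega⟩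
    have t1 := tri (v a) x (v b)
    have t2 := tri x y (v b)
    have t3 := hv a b ha hb
    have t4 : G.dist (v a) x = G.dist x (v a) := dist_comm
    have l1 : k' < k + 2 := by
      by_contra hcon
      have := Nat.mul_le_mul_left (2 * lam) (not_lt.1 hcon)
      rw [Nat.mul_add] at this
      omega
    have l2 : k < k' + 2 := by
      by_contra hcon
      have := Nat.mul_le_mul_left (2 * lam) (not_lt.1 hcon)
      rw [Nat.mul_add] at this
      omega
    obtain h | h | h : k' = k ∨ k' = k + 1 ∨ k = k' + 1 := by omega
    · subst h
      exact ⟨k', hk', by omega, by omega⟩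
    · have : 2 * lam * k' = 2 * lam * k + 2 * lam := by rw [h, Nat.mul_succ]
      exact ⟨k, hk, by omega, by omega⟩
    · have : 2 * lam * k = 2 * lam * k' + 2 * lam := by rw [h, Nat.mul_succ]
      exact ⟨k', hk', by omega, by omega⟩
  · intro x i j k hij hjk hk hi hk'
    simp only [closedBall, Set.mem_setOf_eq] at hi hk' ⊢
    rcases hij.eq_or_lt with rfl | hij
    · exact hi
    rcases hjk.eq_or_lt with rfl | hjk
    · exact hk'
    have ci := cle i (by omega)
    have cj := cle j (by omega)
    have ck := cle k hk
    have t1 := tri (v (s + 2 * lam * i)) x (v (s + 2 * lam * k))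
    have t4 : G.dist (v (s + 2 * lam * i)) x = G.dist x (v (s + 2 * lam * i)) := dist_comm
    have t3 := hv _ _ ci ck
    have l : k < i + 3 := by
      by_contra hcon
      have := Nat.mul_le_mul_left (2 * lam) (not_lt.1 hcon)
      rw [Nat.mul_add] at this
      omega
    have e1 : 2 * lam * j = 2 * lam * i + 2 * lam := by
      rw [show j = i + 1 by omega, Nat.mul_succ]
    have e2 : 2 * lam * k = 2 * lam * j + 2 * lam := by
      rw [show k = j + 1 by omega, Nat.mul_succ]
    obtain ⟨a, ha, hxa⟩ := hc x
    have u0 : G.dist (v a) x = G.dist x (v a) := dist_comm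
    have u1 := tri (v a) x (v (s + 2 * lam * i))
    have u2 := tri (v a) x (v (s + 2 * lam * k))
    have u3 := hv a _ ha ci
    have u4 := hv a _ ha ck
    have u5 := hv a _ ha cj
    have u6 := tri x (v a) (v (s + 2 * lam * j))
    omega
end

section
/- Every finite connected AT-free graph G admits a path decomposition in which every bag is the complete closed 2-neighbourhood N^2[q] of some vertex q; in particular, spb(G) ≤ 2 for every connected AT-free graph G. -/
open SimpleGraph

/-- `G` is AT-free: it contains no asteroidal triple, i.e. no independent set
`{a, b, c}` of three vertices such that each pair of them is joined by a path avoiding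
the closed neighbourhood of the third vertex. -/
def ATFree {V : Type*} (G : SimpleGraph V) : Prop :=
  ¬ ∃ a b c : V, a ≠ b ∧ a ≠ c ∧ b ≠ c ∧
    ¬ G.Adj a b ∧ ¬ G.Adj a c ∧ ¬ G.Adj b c ∧
    (∃ w : G.Walk a b, ∀ u ∈ w.support, u ∉ insert c (G.neighborSet c)) ∧
    (∃ w : G.Walk a c, ∀ u ∈ w.support, u ∉ insert b (G.neighborSet b)) ∧
    (∃ w : G.Walk b c, ∀ u ∈ w.support, u ∉ insert a (G.neighborSet a))


namespace ATF

variable {V : Type*} {G : SimpleGraph V}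

/-- `v` is outside the closed neighbourhood of `c`. -/
def Far (G : SimpleGraph V) (c v : V) : Prop := v ∉ insert c (G.neighborSet c)

/-- `u` and `w` are joined by a walk avoiding the closed neighbourhood of `c`. -/
def R (G : SimpleGraph V) (c u w : V) : Prop :=
  ∃ p : G.Walk u w, ∀ v ∈ p.support, v ∉ insert c (G.neighborSet c)

lemma far_iff {c v : V} : Far G c v ↔ v ≠ c ∧ ¬ G.Adj c v := by
  simp [Far]

lemma Far.symm {c v : V} (h : Far G c v) : Far G v c := by
  rw [far_iff] at *
  exact ⟨fun e => h.1 e.symm, fun e => h.2 e.symm⟩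

lemma R.left {c u w : V} (h : R G c u w) : Far G c u := by
  obtain ⟨p, hp⟩ := h
  exact hp _ p.start_mem_support

lemma R.right {c u w : V} (h : R G c u w) : Far G c w := by
  obtain ⟨p, hp⟩ := h
  exact hp _ p.end_mem_support

lemma R.refl {c u : V} (h : Far G c u) : R G c u u :=
  ⟨Walk.nil, by simpa [Far] using h⟩

lemma R.symm {c u w : V} (h : R G c u w) : R G c w u := by
  obtain ⟨p, hp⟩ := h
  exact ⟨p.reverse, by simpa using hp⟩

lemma R.trans {c u v w : V} (h : R G c u v) (h' : R G c v w) : R G c u w := by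
  obtain ⟨p, hp⟩ := h
  obtain ⟨q, hq⟩ := h'
  refine ⟨p.append q, fun x hx => ?_⟩
  rcases (Walk.mem_support_append_iff _ _).1 hx with h | h
  · exact hp _ h
  · exact hq _ h

lemma R.step {c u w : V} (hu : Far G c u) (hw : Far G c w) (h : G.Adj u w) : R G c u w := by
  refine ⟨Walk.cons h Walk.nil, fun x hx => ?_⟩
  simp only [Walk.support_cons, Walk.support_nil, List.mem_cons, List.not_mem_nil, or_false] at hx
  rcases hx with rfl | rfl
  · exact hu
  · exact hw

/-- If `z` misses a walk witnessing `R c u w` nowhere, `R z` fails; split version. -/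
lemma R.split {c u w z : V} (h : R G c u w) (hz : ¬ R G z u w) :
    ∃ v, R G c u v ∧ R G c v w ∧ ¬ Far G z v := by
  classical
  obtain ⟨p, hp⟩ := h
  have : ∃ v ∈ p.support, ¬ Far G z v := by
    by_contra hcon
    push Not at hcon
    exact hz ⟨p, hcon⟩
  obtain ⟨v, hv, hvz⟩ := this
  refine ⟨v, ⟨p.takeUntil v hv, fun x hx => hp _ (p.support_takeUntil_subset_support hv hx)⟩,
    ⟨p.dropUntil v hv, fun x hx => hp _ (p.support_dropUntil_subset_support hv hx)⟩, hvz⟩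

open Classical in
/-- Component of `u` outside the closed neighbourhood of `x`. -/
noncomputable def C [Fintype V] (G : SimpleGraph V) (x u : V) : Finset V :=
  Finset.univ.filter (fun w => R G x u w)

open Classical in
noncomputable def Phi [Fintype V] (G : SimpleGraph V) (x : V) : ℕ :=
  ∑ u ∈ Finset.univ.filter (fun u => Far G x u), 3 ^ (C G x u).card

lemma mem_C [Fintype V] {x u w : V} : w ∈ C G x u ↔ R G x u w := by
  simp [C]

lemma phi_lt [Fintype V] {x a b : V} (hab : ¬ R G x a b) (h1 : R G b a x) (h2 : R G a b x)
    (hc : (C G x a).card ≤ (C G x b).card) : Phi G x < Phi G a := by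
  classical
  have hxa : Far G x a := h2.right.symm
  have hxb : Far G x b := h1.right.symm
  have key : ∀ u, Far G x u → ¬ R G x a u → Far G a u := by
    intro u hu hau
    by_contra hcon
    rw [far_iff] at hcon
    by_cases e : u = a
    · subst e; exact hau (R.refl hu)
    · have : G.Adj a u := by
        by_contra h; exact hcon ⟨e, h⟩
      exact hau (R.step hxa hu this)
  have sub : ∀ u, ¬ R G x a u → C G x u ⊆ C G a u := by
    intro u hau w hw
    rw [mem_C] at *
    by_contra hcon
    obtain ⟨v, hv1, hv2, hv3⟩ := hw.split hcon
    exact hv3 (key v hv1.right (fun h => hau (h.trans hv1.symm)))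
  set F := Finset.univ.filter (fun u => Far G x u) with hF
  set A := C G x a with hA
  set B := C G x b with hB
  have hAF : A ⊆ F := by
    intro u hu
    rw [hA, mem_C] at hu
    simpa [hF] using hu.right
  have hBS : B ⊆ F \ A := by
    intro u hu
    rw [hB, mem_C] at hu
    rw [Finset.mem_sdiff, hA, mem_C]
    exact ⟨by simpa [hF] using hu.right, fun h => hab (h.trans hu.symm)⟩
  have eqC : ∀ c u, u ∈ C G x c → C G x u = C G x c := by
    intro c u hu
    rw [mem_C] at hu
    ext w
    rw [mem_C, mem_C]
    exact ⟨fun h => hu.trans h, fun h => hu.symm.trans h⟩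
  have e1 : Phi G x = ∑ u ∈ (F \ A) \ B, 3 ^ (C G x u).card + B.card * 3 ^ B.card
      + A.card * 3 ^ A.card := by
    have s1 : ∑ u ∈ A, 3 ^ (C G x u).card = A.card * 3 ^ A.card := by
      rw [Finset.sum_congr rfl (fun u hu => by rw [eqC a u hu])]
      simp [hA]
    have s2 : ∑ u ∈ B, 3 ^ (C G x u).card = B.card * 3 ^ B.card := by
      rw [Finset.sum_congr rfl (fun u hu => by rw [eqC b u hu])]
      simp [hB]
    rw [← s1, ← s2, Finset.sum_sdiff hBS, Finset.sum_sdiff hAF]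
    rfl
  have e2 : ∑ u ∈ (F \ A) \ B, 3 ^ (C G x u).card + B.card * 3 ^ (B.card + 1) ≤ Phi G a := by
    have s3 : ∑ u ∈ F \ A, 3 ^ (C G a u).card ≤ Phi G a := by
      apply Finset.sum_le_sum_of_subset
      intro u hu
      rw [Finset.mem_sdiff, hA, mem_C] at hu
      have : Far G x u := by simpa [hF] using hu.1
      simpa using key u this hu.2
    refine le_trans ?_ s3
    rw [← Finset.sum_sdiff hBS]
    apply add_le_add
    · apply Finset.sum_le_sum
      intro u hu
      rw [Finset.mem_sdiff, Finset.mem_sdiff, hA, mem_C] at hu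
      exact Nat.pow_le_pow_right (by norm_num) (Finset.card_le_card (sub u hu.1.2))
    · rw [← smul_eq_mul]
      apply Finset.card_nsmul_le_sum
      intro u hu
      apply Nat.pow_le_pow_right (by norm_num)
      have hu' := Finset.mem_sdiff.1 (hBS hu)
      have hau : ¬ R G x a u := fun h => hu'.2 (by rw [hA, mem_C]; exact h)
      rw [hB, ← eqC b u hu]
      apply Nat.succ_le_of_lt
      apply Finset.card_lt_card
      refine ⟨sub u hau, fun hcon => ?_⟩
      have hub : R G x u b := by
        rw [hB, mem_C] at hu; exact hu.symm
      have hub' : R G a u b := by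
        have := sub u hau (mem_C.2 hub)
        exact mem_C.1 this
      have := mem_C.1 (hcon (mem_C.2 (hub'.trans h2)))
      have := this.right
      simp [Far] at this
  have hpos : 0 < B.card := Finset.card_pos.2 ⟨b, by rw [hB, mem_C]; exact R.refl hxb⟩
  have h3 : A.card * 3 ^ A.card ≤ B.card * 3 ^ B.card :=
    Nat.mul_le_mul hc (Nat.pow_le_pow_right (by norm_num) hc)
  have h4 : 0 < B.card * 3 ^ B.card := by positivity
  have h5 : B.card * 3 ^ (B.card + 1) = 3 * (B.card * 3 ^ B.card) := by ring
  omega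

lemma exists_admissible [Fintype V] [Nonempty V] (hAT : ATFree G) :
    ∃ x, ∀ a b, ¬ (R G b a x ∧ R G a b x) := by
  obtain ⟨x, -, hx⟩ := Finset.exists_max_image (Finset.univ : Finset V) (Phi G)
    Finset.univ_nonempty
  refine ⟨x, fun a b ⟨h1, h2⟩ => ?_⟩
  have hab : ¬ R G x a b := by
    intro h
    have f1 := far_iff.1 h1.left
    have f2 := far_iff.1 h1.right
    have f3 := far_iff.1 h2.right
    exact hAT ⟨a, b, x, f1.1, f3.1.symm, f2.1.symm, fun e => f1.2 e.symm, f3.2, f2.2, h, h1, h2⟩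
  rcases le_total (C G x a).card (C G x b).card with hc | hc
  · exact absurd (hx a (Finset.mem_univ _)) (not_le.2 (phi_lt hab h1 h2 hc))
  · exact absurd (hx b (Finset.mem_univ _))
      (not_le.2 (phi_lt (fun h => hab h.symm) h2 h1 hc))

lemma exists_pair [Fintype V] [Nonempty V] (hAT : ATFree G) :
    ∃ x y, ∀ u, ¬ R G u x y := by
  classical
  obtain ⟨x, hx⟩ := exists_admissible hAT
  let D : V → Finset V := fun y => Finset.univ.filter (fun u => ¬ R G u y x)
  obtain ⟨y, -, hy⟩ := Finset.exists_max_image (Finset.univ : Finset V) (fun y => (D y).card)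
    Finset.univ_nonempty
  refine ⟨x, y, fun u hu' => ?_⟩
  have hu : R G u y x := hu'.symm
  refine absurd (hy u (Finset.mem_univ _)) (not_le.2 (Finset.card_lt_card ⟨?_, ?_⟩))
  · intro w hw
    simp only [D, Finset.mem_filter, Finset.mem_univ, true_and] at hw ⊢
    intro hwu
    have hyu : ¬ R G y u x := fun h => hx _ _ ⟨h, hu⟩
    by_cases hf : Far G w y
    · obtain ⟨v, hv1, hv2, hv3⟩ := hwu.split hyu
      by_cases e : v = y
      · subst e; exact hw hv2
      · have hadj : G.Adj y v := by
          by_contra h; exact hv3 (far_iff.2 ⟨e, h⟩)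
        exact hw ((R.step hf hv1.right hadj).trans hv2)
    · by_cases e : y = w
      · subst e; exact hyu hwu
      · have hadj : G.Adj w y := by
          by_contra h; exact hf (far_iff.2 ⟨e, h⟩)
        exact hx _ _ ⟨hwu, (R.step hwu.left.symm hu.left hadj).trans hu⟩
  · intro hcon
    have : u ∈ D y := hcon (by
      simp only [D, Finset.mem_filter, Finset.mem_univ, true_and]
      intro h
      have := h.left
      simp [Far] at this)
    simp only [D, Finset.mem_filter, Finset.mem_univ, true_and] at this
    exact this hu

lemma far_dist (hG : G.Connected) {c v : V} : Far G c v ↔ 2 ≤ G.dist v c := by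
  rw [far_iff]
  have h0 : G.dist v c = 0 ↔ v = c := hG.dist_eq_zero_iff
  have h1 : G.dist v c = 1 ↔ G.Adj v c := SimpleGraph.dist_eq_one_iff_adj
  rw [G.adj_comm] at h1
  constructor
  · rintro ⟨a, b⟩
    have := mt h0.1 a
    have := mt h1.1 b
    omega
  · intro h
    exact ⟨fun e => by have := h0.2 e; omega, fun e => by have := h1.2 e; omega⟩

lemma R.step' (hG : G.Connected) {c u w : V} (hu : Far G c u) (hw : Far G c w)
    (h : G.dist u w ≤ 1) : R G c u w := by
  by_cases e : Far G w u
  · rw [far_dist hG] at e; omega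
  · by_cases e' : u = w
    · subst e'; exact R.refl hu
    · have hadj : G.Adj w u := by
        by_contra h; exact e (far_iff.2 ⟨e', h⟩)
      exact R.step hu hw hadj.symm

lemma mid (hG : G.Connected) {a b : V} (h : G.dist a b ≤ 2) :
    ∃ v, G.dist a v ≤ 1 ∧ G.dist v b ≤ 1 := by
  obtain ⟨p, hp⟩ := hG.exists_walk_length_eq_dist a b
  refine ⟨p.getVert 1, ?_, ?_⟩
  · refine (SimpleGraph.dist_le (p.take 1)).trans ?_
    simp
  · refine (SimpleGraph.dist_le (p.drop 1)).trans ?_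
    simp; omega

end ATF

open ATF in
theorem atFree_strong_pathbreadth_le_two {V : Type*} [Fintype V]
    (G : SimpleGraph V) (hG : G.Connected) (hAT : ATFree G) :
    (∃ D : PathDecomp G, HasStrongBreadth G D 2) ∧ spb G ≤ 2 := by
  suffices h : ∃ D : PathDecomp G, HasStrongBreadth G D 2 from ⟨h, Nat.sInf_le h⟩
  haveI := hG.nonempty
  obtain ⟨x, y, hxy⟩ := exists_pair hAT
  obtain ⟨w, hw⟩ := hG.exists_walk_length_eq_dist x y
  set k := w.length with hk
  let p : ℕ → V := w.getVert
  have p0 : p 0 = x := by simp [p]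
  have pk : p k = y := by simp [p, hk]
  have tri : ∀ a b c, G.dist a c ≤ G.dist a b + G.dist b c := fun a b c => hG.dist_triangle
  have sy : ∀ a b, G.dist a b = G.dist b a := fun a b => SimpleGraph.dist_comm
  have d1 : ∀ i, G.dist (p i) (p (i+1)) ≤ 1 := by
    intro i
    rcases lt_or_ge i k with h | h
    · exact (SimpleGraph.dist_eq_one_iff_adj.2 (w.adj_getVert_succ h)).le
    · have e1 : p i = y := w.getVert_of_length_le h
      have e2 : p (i+1) = y := w.getVert_of_length_le (by omega)
      rw [e1, e2]; simp
  have d2 : ∀ i n, G.dist (p i) (p (i+n)) ≤ n := by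
    intro i n
    induction n with
    | zero => simp
    | succ n ih =>
      have := tri (p i) (p (i+n)) (p (i+n+1))
      have := d1 (i+n)
      rw [← add_assoc]
      omega
  have d3 : ∀ i j, i ≤ j → j ≤ k → j - i ≤ G.dist (p i) (p j) := by
    intro i j hij hj
    have a1 := d2 0 i
    have a2 := d2 j (k - j)
    rw [zero_add, p0] at a1
    rw [Nat.add_sub_cancel' hj, pk] at a2
    have := tri x (p i) y
    have := tri (p i) (p j) y
    omega
  have dom : ∀ a, ∃ l ≤ k, G.dist a (p l) ≤ 1 := by
    intro a
    by_contra hcon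
    push Not at hcon
    refine hxy a ⟨w, fun v hv => ?_⟩
    obtain ⟨n, hn, hnk⟩ := Walk.mem_support_iff_exists_getVert.1 hv
    have := hcon n hnk
    refine (far_dist hG).2 ?_
    rw [← hn, sy]
    exact this
  have cov : ∀ a b, G.dist a b ≤ 1 →
      ∃ i ≤ k / 2, G.dist a (p (2*i)) ≤ 2 ∧ G.dist b (p (2*i)) ≤ 2 := by
    intro a b hab
    obtain ⟨l, hl, hal⟩ := dom a
    obtain ⟨m, hm, hbm⟩ := dom b
    rcases Nat.even_or_odd' l with ⟨l', rfl | rfl⟩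
    · refine ⟨l', by omega, by omega, ?_⟩
      have := tri b a (p (2*l'))
      rw [sy b a] at this
      omega
    rcases Nat.even_or_odd' m with ⟨m', rfl | rfl⟩
    · refine ⟨m', by omega, ?_, by omega⟩
      have := tri a b (p (2*m'))
      omega
    have t1 := tri (p (2*l'+1)) a (p (2*m'+1))
    have t2 := tri a b (p (2*m'+1))
    rw [sy _ a] at t1
    have l0 := d1 (2*l')
    have m0 := d1 (2*m')
    have a1 := tri a (p (2*l'+1)) (p (2*l'))
    have b1 := tri b (p (2*m'+1)) (p (2*m'))
    rw [sy (p (2*l'+1)) (p (2*l'))] at a1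
    rw [sy (p (2*m'+1)) (p (2*m'))] at b1
    rcases lt_trichotomy l' m' with h | h | h
    · have := d3 (2*l'+1) (2*m'+1) (by omega) hm
      have e : m' = l' + 1 := by omega
      subst e
      refine ⟨l'+1, by omega, ?_, by omega⟩
      have := tri a (p (2*l'+1)) (p (2*(l'+1)))
      have := d1 (2*l'+1)
      have e2 : 2*l'+1+1 = 2*(l'+1) := by ring
      rw [e2] at this
      omega
    · subst h
      exact ⟨l', by omega, by omega, by omega⟩
    · have := d3 (2*m'+1) (2*l'+1) (by omega) hl
      rw [sy (p (2*m'+1)) (p (2*l'+1))] at this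
      have e : l' = m' + 1 := by omega
      subst e
      refine ⟨m'+1, by omega, by omega, ?_⟩
      have := tri b (p (2*m'+1)) (p (2*(m'+1)))
      have := d1 (2*m'+1)
      have e2 : 2*m'+1+1 = 2*(m'+1) := by ring
      rw [e2] at this
      omega
  refine ⟨⟨k / 2, fun i => closedBall G (p (2*i)) 2, ?_, ?_, ?_⟩, fun i _ => ⟨_, rfl⟩⟩
  · intro a
    obtain ⟨i, hi, h, -⟩ := cov a a (by simp)
    exact ⟨i, hi, h⟩
  · intro a b hab
    obtain ⟨i, hi, h, h'⟩ := cov a b (SimpleGraph.dist_eq_one_iff_adj.2 hab).le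
    exact ⟨i, hi, h, h'⟩
  · intro u i j m hij hjm hm hui hum
    rcases eq_or_lt_of_le hij with rfl | hij
    · exact hui
    rcases eq_or_lt_of_le hjm with rfl | hjm
    · exact hum
    by_contra hcon
    replace hui : G.dist u (p (2*i)) ≤ 2 := hui
    replace hum : G.dist u (p (2*m)) ≤ 2 := hum
    replace hcon : ¬ G.dist u (p (2*j)) ≤ 2 := hcon
    set c := p (2*j) with hc
    have fu : Far G c u := (far_dist hG).2 (by omega)
    have fl : ∀ l, l ≤ 2*i → Far G c (p l) := by
      intro l hl
      have := d3 l (2*j) (by omega) (by omega)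
      exact (far_dist hG).2 (by rw [hc]; omega)
    have fr : ∀ l, 2*m ≤ l → l ≤ k → Far G c (p l) := by
      intro l hl hlk
      have := d3 (2*j) l (by omega) (by omega)
      exact (far_dist hG).2 (by rw [hc, sy]; omega)
    have fmid : ∀ v, G.dist u v ≤ 1 → Far G c v := by
      intro v hv
      have := tri u v c
      exact (far_dist hG).2 (by omega)
    have r1 : ∀ l, l ≤ 2*i → R G c x (p l) := by
      intro l
      induction l with
      | zero => intro h; rw [p0]; exact R.refl (p0 ▸ fl 0 h)
      | succ l ih =>
        intro h
        exact (ih (by omega)).trans (R.step' hG (fl l (by omega)) (fl (l+1) h) (d1 l))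
    have r2 : ∀ n, 2*m + n ≤ k → R G c (p (2*m)) (p (2*m+n)) := by
      intro n
      induction n with
      | zero => intro h; exact R.refl (fr _ le_rfl h)
      | succ n ih =>
        intro h
        exact (ih (by omega)).trans
          (R.step' hG (fr _ (by omega) (by omega)) (fr (2*m+n+1) (by omega) h) (d1 _))
    have r3 : ∀ q, Far G c q → G.dist u q ≤ 2 → R G c u q := by
      intro q hq hd
      obtain ⟨v, hv1, hv2⟩ := mid hG hd
      exact (R.step' hG fu (fmid v hv1) hv1).trans (R.step' hG (fmid v hv1) hq hv2)
    have r4 := r2 (k - 2*m) (by omega)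
    rw [Nat.add_sub_cancel' (by omega), pk] at r4
    exact hxy c ((((r1 _ le_rfl).trans (r3 _ (fl _ le_rfl) hui).symm).trans
      (r3 _ (fr _ le_rfl (by omega)) hum)).trans r4)
end

section
/- Let G be a finite connected graph and let k be the minimum eccentricity over all shortest paths of G. If P is a shortest path of G with eccentricity φ·k + ψ ≥ 1 (for reals φ, ψ ≥ 0), then G admits a path decomposition with strong breadth 2(φ·k + ψ), and this strong breadth is at most 4φ·spb(G) + 2ψ. -/
open SimpleGraph

lemma aux_ul {V : Type*} (G : SimpleGraph V) (hG : G.Connected) (ℓ : ℕ) (f : ℕ → V)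
    (ha : ∀ i < ℓ, G.Adj (f i) (f (i + 1))) (i n : ℕ) (h : i + n ≤ ℓ) :
    G.dist (f i) (f (i + n)) ≤ n := by
  induction n with
  | zero => simp
  | succ n ih =>
    have h1 := ih (by omega)
    have h2 : G.dist (f (i + n)) (f (i + n + 1)) = 1 :=
      SimpleGraph.dist_eq_one_iff_adj.2 (ha (i + n) (by omega))
    have h3 := hG.dist_triangle (u := f i) (v := f (i + n)) (w := f (i + n + 1))
    rw [← add_assoc]
    omega

lemma aux_exact {V : Type*} (G : SimpleGraph V) (hG : G.Connected) (ℓ : ℕ) (f : ℕ → V)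
    (ha : ∀ i < ℓ, G.Adj (f i) (f (i + 1))) (hl : G.dist (f 0) (f ℓ) = ℓ)
    (i j : ℕ) (hij : i ≤ j) (h : j ≤ ℓ) :
    G.dist (f i) (f j) = j - i := by
  have h1 := aux_ul G hG ℓ f ha 0 i (by omega)
  have h2 := aux_ul G hG ℓ f ha i (j - i) (by omega)
  have h3 := aux_ul G hG ℓ f ha j (ℓ - j) (by omega)
  rw [show 0 + i = i by omega] at h1
  rw [show i + (j - i) = j by omega] at h2
  rw [show j + (ℓ - j) = ℓ by omega] at h3
  have h4 := hG.dist_triangle (u := f 0) (v := f i) (w := f ℓ)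
  have h5 := hG.dist_triangle (u := f i) (v := f j) (w := f ℓ)
  omega

lemma exists_sp {V : Type*} (G : SimpleGraph V) (hG : G.Connected) (x y : V) :
    ∃ (ℓ : ℕ) (f : ℕ → V), IsShortestPath G ℓ f ∧ f 0 = x ∧ f ℓ = y := by
  obtain ⟨p, hp⟩ := hG.exists_walk_length_eq_dist x y
  have ha : ∀ i < p.length, G.Adj (p.getVert i) (p.getVert (i + 1)) :=
    fun i hi => p.adj_getVert_succ hi
  have hl : G.dist (p.getVert 0) (p.getVert p.length) = p.length := by
    rw [p.getVert_zero, p.getVert_length, hp]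
  refine ⟨p.length, p.getVert, ⟨ha, ?_⟩, by simp, by simp⟩
  intro i j hi hj
  rcases le_total i j with h | h
  · rw [aux_exact G hG _ _ ha hl i j h hj]; omega
  · rw [SimpleGraph.dist_comm, aux_exact G hG _ _ ha hl j i h hi]; omega

lemma path_meets {V : Type*} (G : SimpleGraph V) (D : PathDecomp G) (ℓ : ℕ) (f : ℕ → V)
    (ha : ∀ i < ℓ, G.Adj (f i) (f (i + 1))) (h0 : f 0 ∈ D.bag 0) (h1 : f ℓ ∈ D.bag D.len)
    (i : ℕ) (hi : i ≤ D.len) : ∃ t ≤ ℓ, f t ∈ D.bag i := by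
  by_contra! hc
  have key : ∀ t ≤ ℓ, ∃ a < i, f t ∈ D.bag a := by
    intro t
    induction t with
    | zero =>
      intro _
      refine ⟨0, ?_, h0⟩
      rcases Nat.eq_zero_or_pos i with h | h
      · subst h; exact absurd h0 (hc 0 (by omega))
      · exact h
    | succ t ih =>
      intro ht
      obtain ⟨a, hai, hat⟩ := ih (by omega)
      obtain ⟨b, hb, hb1, hb2⟩ := D.edge_bag _ _ (ha t (by omega))
      refine ⟨b, ?_, hb2⟩
      by_contra! hib
      exact hc t (by omega) (D.consec _ a i b (by omega) hib hb hat hb1)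
  obtain ⟨a, hai, hat⟩ := key ℓ le_rfl
  exact hc ℓ le_rfl (D.consec _ a i D.len (by omega) hi le_rfl hat h1)

lemma exists_ecc {V : Type*} [Fintype V] (G : SimpleGraph V) [Nonempty V] (ℓ : ℕ) (f : ℕ → V)
    (r : ℕ) (h : ∀ u : V, ∃ i ≤ ℓ, G.dist u (f i) ≤ r) : ∃ e ≤ r, PathEcc G ℓ f e := by
  classical
  have hex : ∃ e, ∀ u : V, ∃ i ≤ ℓ, G.dist u (f i) ≤ e := ⟨r, h⟩
  refine ⟨Nat.find hex, Nat.find_min' hex h, Nat.find_spec hex, ?_⟩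
  by_contra! hc
  rcases Nat.eq_zero_or_pos (Nat.find hex) with h0 | h0
  · obtain ⟨i, _, hi⟩ := hc (Classical.arbitrary V)
    omega
  · refine Nat.find_min hex (m := Nat.find hex - 1) (by omega) ?_
    intro u
    obtain ⟨i, hi, hi'⟩ := hc u
    exact ⟨i, hi, by omega⟩

lemma k_le {V : Type*} [Fintype V] (G : SimpleGraph V) (hG : G.Connected) (k : ℕ)
    (hk : IsLeast {e : ℕ | ∃ (ℓ : ℕ) (v : ℕ → V),
      IsShortestPath G ℓ v ∧ PathEcc G ℓ v e} k)
    (D : PathDecomp G) (r : ℕ) (hD : HasStrongBreadth G D r) : k ≤ 2 * r := by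
  have := hG.nonempty
  obtain ⟨x, hx⟩ := hD 0 (by omega)
  obtain ⟨y, hy⟩ := hD D.len le_rfl
  obtain ⟨ℓ, f, hf, f0, f1⟩ := exists_sp G hG x y
  have hm := path_meets G D ℓ f hf.1 (by rw [hx, f0]; simp [closedBall])
    (by rw [hy, f1]; simp [closedBall])
  obtain ⟨e, he, he'⟩ := exists_ecc G ℓ f (2 * r) (by
    intro u
    obtain ⟨i, hi, hu⟩ := D.mem_bag u
    obtain ⟨t, ht, htb⟩ := hm i hi
    obtain ⟨c, hc⟩ := hD i hi
    rw [hc] at hu htb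
    simp only [closedBall, Set.mem_setOf_eq] at hu htb
    refine ⟨t, ht, ?_⟩
    have := hG.dist_triangle (u := u) (v := c) (w := f t)
    rw [SimpleGraph.dist_comm (u := c)] at this
    omega)
  exact (hk.2 ⟨ℓ, f, hf, he'⟩).trans he

lemma exists_decomp {V : Type*} (G : SimpleGraph V) (hG : G.Connected)
    (ℓ lam : ℕ) (v : ℕ → V) (hsp : IsShortestPath G ℓ v)
    (hecc : ∀ u : V, ∃ i ≤ ℓ, G.dist u (v i) ≤ lam) (hl : 1 ≤ lam) :
    ∃ D : PathDecomp G, HasStrongBreadth G D (2 * lam) := by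
  obtain ⟨s, q, hs, hq, hq'⟩ : ∃ s q : ℕ, s ≤ lam ∧ s + 2 * lam * q ≤ ℓ ∧
      ℓ ≤ s + 2 * lam * q + lam := by
    have h1 := Nat.div_add_mod ℓ (2 * lam)
    have h2 := Nat.mod_lt ℓ (show 2 * lam > 0 by omega)
    by_cases h : ℓ % (2 * lam) ≤ lam
    · exact ⟨0, ℓ / (2 * lam), by omega, by omega, by omega⟩
    · exact ⟨lam, ℓ / (2 * lam), by omega, by omega, by omega⟩
  -- monotonicity of the centres, in a form usable by omega
  have mono : ∀ i j : ℕ, i ≤ j → 2 * lam * i ≤ 2 * lam * j := fun i j h => by gcongr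
  have step : ∀ i j : ℕ, i < j → 2 * lam * i + 2 * lam ≤ 2 * lam * j := fun i j h => by
    have := mono (i + 1) j h
    rwa [Nat.mul_succ] at this
  have near : ∀ m ≤ ℓ, ∃ i ≤ q, m ≤ s + 2 * lam * i + lam ∧ s + 2 * lam * i ≤ m + lam := by
    intro m hm
    have h1 := Nat.div_add_mod (m + lam - s) (2 * lam)
    have h2 := Nat.mod_lt (m + lam - s) (show 2 * lam > 0 by omega)
    by_cases h : (m + lam - s) / (2 * lam) ≤ q
    · exact ⟨_, h, by omega, by omega⟩
    · have := step q _ (not_le.1 h)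
      exact ⟨q, le_rfl, by omega, by omega⟩
  choose μ hμ hμd using hecc
  have up : ∀ (x : V) (i : ℕ), i ≤ ℓ → ∀ n, i ≤ μ x + n → μ x ≤ i + n →
      G.dist x (v i) ≤ G.dist x (v (μ x)) + n := by
    intro x i hi n h1 h2
    have := hG.dist_triangle (u := x) (v := v (μ x)) (w := v i)
    rw [hsp.2 _ _ (hμ x) hi] at this
    omega
  have low : ∀ (x : V) (i : ℕ), i ≤ ℓ → G.dist x (v i) ≤ 2 * lam →
      i ≤ μ x + 3 * lam ∧ μ x ≤ i + 3 * lam := by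
    intro x i hi h
    have := hG.dist_triangle (u := v (μ x)) (v := x) (w := v i)
    rw [hsp.2 _ _ (hμ x) hi, SimpleGraph.dist_comm (u := v (μ x))] at this
    have := hμd x
    omega
  have cl : ∀ i ≤ q, s + 2 * lam * i ≤ ℓ := fun i h => by have := mono i q h; omega
  have inb : ∀ (x : V) (i : ℕ), i ≤ q → s + 2 * lam * i ≤ μ x + lam →
      μ x ≤ s + 2 * lam * i + lam → G.dist x (v (s + 2 * lam * i)) ≤ 2 * lam := by
    intro x i hi h1 h2
    have := up x _ (cl i hi) lam h1 h2
    have := hμd x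
    omega
  have inb' : ∀ (x y : V) (i : ℕ), G.Adj x y → i ≤ q → s + 2 * lam * i + 1 ≤ μ x + lam →
      μ x + 1 ≤ s + 2 * lam * i + lam → G.dist y (v (s + 2 * lam * i)) ≤ 2 * lam := by
    intro x y i hxy hi h1 h2
    have := up x _ (cl i hi) (lam - 1) (by omega) (by omega)
    have := hμd x
    have h3 := hG.dist_triangle (u := y) (v := x) (w := v (s + 2 * lam * i))
    rw [SimpleGraph.dist_eq_one_iff_adj.2 hxy.symm] at h3
    omega
  have wl : ∀ (x y : V) (i j : ℕ), G.Adj x y → i ≤ j → j ≤ q →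
      (μ x ≤ s + 2 * lam * i + lam ∧ s + 2 * lam * i ≤ μ x + lam) →
      (μ y ≤ s + 2 * lam * j + lam ∧ s + 2 * lam * j ≤ μ y + lam) →
      ∃ c ≤ q, G.dist x (v (s + 2 * lam * c)) ≤ 2 * lam ∧
        G.dist y (v (s + 2 * lam * c)) ≤ 2 * lam := by
    intro x y i j hxy hij hj hx hy
    by_cases ex : s + 2 * lam * i + 1 ≤ μ x + lam ∧ μ x + 1 ≤ s + 2 * lam * i + lam
    · exact ⟨i, by omega, inb x i (by omega) hx.2 hx.1, inb' x y i hxy (by omega) ex.1 ex.2⟩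
    by_cases ey : s + 2 * lam * j + 1 ≤ μ y + lam ∧ μ y + 1 ≤ s + 2 * lam * j + lam
    · exact ⟨j, by omega, inb' y x j hxy.symm (by omega) ey.1 ey.2, inb y j (by omega) hy.2 hy.1⟩
    have hd : μ y ≤ μ x + 2 * lam + 1 := by
      have h1 := hG.dist_triangle (u := v (μ x)) (v := x) (w := v (μ y))
      have h2 := hG.dist_triangle (u := x) (v := y) (w := v (μ y))
      rw [hsp.2 _ _ (hμ x) (hμ y), SimpleGraph.dist_comm (u := v (μ x))] at h1
      rw [SimpleGraph.dist_eq_one_iff_adj.2 hxy] at h2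
      have := hμd x
      have := hμd y
      omega
    rcases hij.eq_or_lt with rfl | hlt
    · exact ⟨i, hj, inb x i hj hx.2 hx.1, inb y i hj hy.2 hy.1⟩
    have e1 : 2 * lam * (i + 1) = 2 * lam * i + 2 * lam := Nat.mul_succ _ _
    have e2 : 2 * lam * (i + 2) = 2 * lam * i + 4 * lam := by ring
    have e3 : 2 * lam * (i + 3) = 2 * lam * i + 6 * lam := by ring
    have ej : 2 * lam * j = 2 * lam * i + 2 * lam ∨ 2 * lam * j = 2 * lam * i + 4 * lam ∨
        2 * lam * i + 6 * lam ≤ 2 * lam * j := by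
      rcases (show j = i + 1 ∨ j = i + 2 ∨ i + 3 ≤ j by omega) with h | h | h
      · left; rw [h, e1]
      · right; left; rw [h, e2]
      · right; right; rw [← e3]; exact mono _ _ h
    by_cases hxe : μ x = s + 2 * lam * i + lam
    · -- x lies in bag i+1
      by_cases hy1 : s + 2 * lam * (i + 1) + lam < μ y
      · exfalso
        omega
      · have := mono (i + 1) j hlt
        exact ⟨i + 1, by omega, inb x _ (by omega) (by omega) (by omega),
          inb y _ (by omega) (by omega) (by omega)⟩
    · have := mono (i + 1) j hlt
      exact ⟨i, by omega, inb x i (by omega) hx.2 hx.1,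
        inb y i (by omega) (by omega) (by omega)⟩
  have cons1 : ∀ (x : V) (i j k : ℕ), i ≤ j → j ≤ k → k ≤ q →
      G.dist x (v (s + 2 * lam * i)) ≤ 2 * lam → G.dist x (v (s + 2 * lam * k)) ≤ 2 * lam →
      G.dist x (v (s + 2 * lam * j)) ≤ 2 * lam := by
    intro x i j k hij hjk hk h1 h2
    rcases hij.eq_or_lt with rfl | hij
    · exact h1
    rcases hjk.eq_or_lt with rfl | hjk
    · exact h2
    have a := low x _ (cl i (by omega)) h1
    have b := low x _ (cl k (by omega)) h2
    have c := step i j hij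
    have d := step j k hjk
    exact inb x j (by omega) (by omega) (by omega)
  refine ⟨⟨q, fun i => closedBall G (v (s + 2 * lam * i)) (2 * lam), ?_, ?_, cons1⟩,
    fun i _ => ⟨_, rfl⟩⟩
  · intro x
    obtain ⟨i, hi, h1, h2⟩ := near _ (hμ x)
    exact ⟨i, hi, inb x i hi h2 h1⟩
  · intro x y hxy
    obtain ⟨i, hi, h1⟩ := near _ (hμ x)
    obtain ⟨j, hj, h2⟩ := near _ (hμ y)
    rcases le_total i j with h | h
    · exact wl x y i j hxy h hj h1 h2
    · obtain ⟨c, hc, h3, h4⟩ := wl y x j i hxy.symm h hi h2 h1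
      exact ⟨c, hc, h4, h3⟩

theorem approx_from_mesp_approx {V : Type*} [Fintype V]
    (G : SimpleGraph V) (hG : G.Connected) (k : ℕ)
    (hk : IsLeast {e : ℕ | ∃ (ℓ : ℕ) (v : ℕ → V),
      IsShortestPath G ℓ v ∧ PathEcc G ℓ v e} k)
    (φ ψ : ℝ) (hφ : 0 ≤ φ) (hψ : 0 ≤ ψ)
    (ℓ lam : ℕ) (v : ℕ → V)
    (hsp : IsShortestPath G ℓ v) (hecc : PathEcc G ℓ v lam)
    (hlam : (lam : ℝ) = φ * k + ψ) (h1 : 1 ≤ φ * (k : ℝ) + ψ) :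
    (∃ D : PathDecomp G, HasStrongBreadth G D (2 * lam)) ∧
    ((2 * lam : ℕ) : ℝ) ≤ 4 * φ * (spb G : ℝ) + 2 * ψ := by
  have hl : 1 ≤ lam := by
    rw [← hlam] at h1
    exact_mod_cast h1
  have hex := exists_decomp G hG ℓ lam v hsp hecc.1 hl
  refine ⟨hex, ?_⟩
  obtain ⟨D, hD⟩ : ∃ D : PathDecomp G, HasStrongBreadth G D (spb G) :=
    Nat.sInf_mem (s := {r | ∃ D : PathDecomp G, HasStrongBreadth G D r}) ⟨_, hex⟩
  have h2 : (k : ℝ) ≤ 2 * (spb G : ℝ) := by exact_mod_cast k_le G hG k hk D _ hD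
  have h3 := mul_le_mul_of_nonneg_left h2 hφ
  push_cast
  rw [hlam]
  linarith
end
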